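/- There exist constants C > 0 and ε₁ > 0 such that for all ε ∈ (0, ε₁), |ε⁴ ∫_{−∞}^{∞} a(τ)⁹ cos(ψ_ε(τ)) dτ − (2√2/15) √(π/2) ε^{−7/2} e^{−1/(3ε³)}| ≤ C ε^{−2} e^{−1/(3ε³)}. -/

import Mathlib

open MeasureTheory

/-- `a(τ) = 2√2/(e^τ + e^{−τ})`. -/
noncomputable def aa (τ : ℝ) : ℝ := 2 * Real.sqrt 2 / (Real.exp τ + Real.exp (-τ))

/-- `ψ_ε(τ)`. -/
noncomputable def psi (ε τ : ℝ) : ℝ :=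
  2 * Real.arctan ((Real.exp τ - Real.exp (-τ)) / 2)
    - (1 / (48 * ε ^ 3)) * (Real.exp (3 * τ) - Real.exp (-(3 * τ)))
    - (3 / (16 * ε ^ 3)) * (Real.exp τ - Real.exp (-τ))

/-- The integrand of the contour integral, after the substitution `w = 1 + i sinh τ`. -/
noncomputable def saddleIntegrand (lam : ℝ) (w : ℂ) : ℂ :=
  Complex.exp (lam * (w ^ 2 - w ^ 3 / 3)) / (w ^ 6 * (2 - w) ^ 4)

/-- The integrand on the line `w = δ (1 + i t)` with `λ = δ⁻²`, up to a power of `δ`. -/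
noncomputable def scaledIntegrand (δ t : ℝ) : ℂ :=
  Complex.exp ((1 + t * Complex.I) ^ 2 - δ * (1 + t * Complex.I) ^ 3 / 3) /
    ((1 + t * Complex.I) ^ 6 * (2 - δ * (1 + t * Complex.I)) ^ 4)

lemma integral_sinh_substitution (g : ℝ → ℝ) :
    ∫ s, g s = ∫ τ, Real.cosh τ * g (Real.sinh τ) := by
  have h := integral_image_eq_integral_abs_deriv_smul (s := Set.univ) (f := Real.sinh)
    (f' := Real.cosh) MeasurableSet.univ
    (fun x _ => (Real.hasDerivAt_sinh x).hasDerivWithinAt) Real.sinh_injective.injOn g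
  rw [Set.image_univ, Real.sinh_surjective.range_eq] at h
  simpa [abs_of_pos (Real.cosh_pos _)] using h

lemma norm_saddleIntegrand_le {lam δ : ℝ} (hlam : 0 ≤ lam) (hδ : 0 < δ) {w : ℂ}
    (h1 : δ ≤ w.re) (h2 : w.re ≤ 1) :
    ‖saddleIntegrand lam w‖ ≤ Real.exp lam / δ ^ 6 * (1 + w.im ^ 2)⁻¹ := by
  have hexp : ‖Complex.exp (lam * (w ^ 2 - w ^ 3 / 3))‖ ≤ Real.exp lam := by
    rw [Complex.norm_exp, Real.exp_le_exp]
    have : ((lam : ℂ) * (w ^ 2 - w ^ 3 / 3)).re =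
        lam * (w.re ^ 2 - w.re ^ 3 / 3 - (1 - w.re) * w.im ^ 2) := by
      have hre : w ^ 2 - w ^ 3 / 3 =
          (w.re ^ 2 - w.re ^ 3 / 3 - (1 - w.re) * w.im ^ 2 : ℝ) +
            (2 * w.re * w.im - w.re ^ 2 * w.im + w.im ^ 3 / 3 : ℝ) * Complex.I := by
        conv_lhs => rw [← Complex.re_add_im w]
        push_cast
        linear_combination (w.im ^ 2 - w.re * w.im ^ 2 - w.im ^ 3 * Complex.I / 3 : ℂ) *
          Complex.I_sq
      rw [Complex.re_ofReal_mul, hre, Complex.add_re, Complex.re_ofReal_mul, Complex.ofReal_re,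
        Complex.I_re, mul_zero, add_zero]
    rw [this]
    have h3 : 0 ≤ (1 - w.re) * w.im ^ 2 := mul_nonneg (by linarith) (sq_nonneg _)
    have h4 : 0 ≤ w.re ^ 3 := pow_nonneg (by linarith) 3
    nlinarith [mul_nonneg hlam (show 0 ≤ 1 - (w.re ^ 2 - w.re ^ 3 / 3 - (1 - w.re) * w.im ^ 2) by
      nlinarith)]
  have hw : δ ^ 2 * (1 + w.im ^ 2) ≤ ‖w‖ ^ 2 := by
    rw [Complex.sq_norm, Complex.normSq_apply]
    nlinarith [mul_nonneg (sq_nonneg w.im) (show 0 ≤ 1 - δ ^ 2 by nlinarith)]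
  have hw6 : δ ^ 6 * (1 + w.im ^ 2) ≤ ‖w‖ ^ 6 := by
    calc δ ^ 6 * (1 + w.im ^ 2) ≤ δ ^ 6 * (1 + w.im ^ 2) ^ 3 := by
          gcongr
          exact le_self_pow₀ (by nlinarith [sq_nonneg w.im]) (by norm_num)
      _ = (δ ^ 2 * (1 + w.im ^ 2)) ^ 3 := by ring
      _ ≤ (‖w‖ ^ 2) ^ 3 := by gcongr
      _ = ‖w‖ ^ 6 := by ring
  have h2w : 1 ≤ ‖2 - w‖ := by
    refine le_trans ?_ (Complex.re_le_norm _)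
    simp
    linarith
  rw [saddleIntegrand, norm_div, norm_mul, norm_pow, norm_pow, ← div_eq_mul_inv, div_div]
  refine div_le_div₀ (Real.exp_pos _).le hexp (by positivity) ?_
  calc δ ^ 6 * (1 + w.im ^ 2) ≤ ‖w‖ ^ 6 := hw6
    _ ≤ ‖w‖ ^ 6 * ‖2 - w‖ ^ 4 := le_mul_of_one_le_right (by positivity) (one_le_pow₀ h2w)

lemma saddleIntegrand_differentiableAt (lam : ℝ) {w : ℂ} (h1 : 0 < w.re) (h2 : w.re ≤ 1) :
    DifferentiableAt ℂ (saddleIntegrand lam) w := by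
  unfold saddleIntegrand
  have hw : w ≠ 0 := by rintro rfl; simp at h1
  have h2w : 2 - w ≠ 0 := by
    intro h
    have := congrArg Complex.re h
    simp at this
    linarith
  refine DifferentiableAt.div (by fun_prop) (by fun_prop) ?_
  positivity

lemma saddleIntegrand_integrable {lam δ : ℝ} (hlam : 0 ≤ lam) (hδ : 0 < δ) (hδ1 : δ ≤ 1) :
    Integrable fun y : ℝ => saddleIntegrand lam (δ + y * Complex.I) := by
  refine (integrable_inv_one_add_sq.const_mul (Real.exp lam / δ ^ 6)).mono' ?_ ?_
  · refine Continuous.aestronglyMeasurable (continuous_iff_continuousAt.2 fun y => ?_)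
    exact ContinuousAt.comp (f := fun y : ℝ => (δ + y * Complex.I : ℂ))
      (saddleIntegrand_differentiableAt lam (by simpa) (by simpa)).continuousAt (by fun_prop)
  · refine Filter.Eventually.of_forall fun y => ?_
    simpa using norm_saddleIntegrand_le hlam hδ (w := δ + y * Complex.I) (by simp) (by simpa)

lemma tendsto_inv_one_add_sq : Filter.Tendsto (fun T : ℝ => (1 + T ^ 2)⁻¹) Filter.atTop (nhds 0) :=
  (Filter.tendsto_atTop_add_const_left _ _ (Filter.tendsto_pow_atTop two_ne_zero)).inv_tendsto_atTop

lemma integral_horizontal_tendsto_zero {lam δ : ℝ} (hlam : 0 ≤ lam) (hδ : 0 < δ) (hδ1 : δ ≤ 1)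
    {f : ℝ → ℝ} (hf : ∀ T, f T ^ 2 = T ^ 2) :
    Filter.Tendsto (fun T : ℝ => ∫ x : ℝ in δ..1, saddleIntegrand lam (x + f T * Complex.I))
      Filter.atTop (nhds 0) := by
  have hlim := (tendsto_inv_one_add_sq.const_mul (Real.exp lam / δ ^ 6)).mul_const |1 - δ|
  rw [mul_zero, zero_mul] at hlim
  refine squeeze_zero_norm (fun T => ?_) hlim
  refine intervalIntegral.norm_integral_le_of_norm_le_const fun x hx => ?_
  rw [Set.uIoc_of_le hδ1] at hx
  have := norm_saddleIntegrand_le hlam hδ (w := x + f T * Complex.I) (by simpa using hx.1.le)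
    (by simpa using hx.2)
  simpa [hf] using this

lemma integral_saddleIntegrand_shift {lam δ : ℝ} (hlam : 0 ≤ lam) (hδ : 0 < δ) (hδ1 : δ ≤ 1) :
    ∫ y : ℝ, saddleIntegrand lam (1 + y * Complex.I) =
      ∫ y : ℝ, saddleIntegrand lam (δ + y * Complex.I) := by
  have hrect (T : ℝ) := Complex.integral_boundary_rect_eq_zero_of_differentiableOn
    (saddleIntegrand lam) (δ + (-T : ℝ) * Complex.I) ((1 : ℝ) + T * Complex.I) (by
      intro w hw
      rw [Complex.mem_reProdIm] at hw
      have h := hw.1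
      simp only [Complex.add_re, Complex.ofReal_re, Complex.re_ofReal_mul, Complex.I_re, mul_zero,
        add_zero, Set.uIcc_of_le hδ1] at h
      exact (saddleIntegrand_differentiableAt lam (hδ.trans_le h.1) h.2).differentiableWithinAt)
  simp only [Complex.add_re, Complex.ofReal_re, Complex.re_ofReal_mul, Complex.I_re, mul_zero,
    add_zero, Complex.add_im, Complex.ofReal_im, Complex.im_ofReal_mul, Complex.I_im, mul_one,
    zero_add] at hrect
  have hvert {c : ℝ} (hc : 0 < c) (hc1 : c ≤ 1) := intervalIntegral_tendsto_integral
    (saddleIntegrand_integrable hlam hc hc1) Filter.tendsto_neg_atTop_atBot Filter.tendsto_id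
  have hlim := (((integral_horizontal_tendsto_zero hlam hδ hδ1 (f := fun T => -T)
    (fun T => neg_sq T)).sub (integral_horizontal_tendsto_zero hlam hδ hδ1 (f := fun T => T)
    (fun T => rfl))).add ((hvert one_pos le_rfl).const_smul Complex.I)).sub
    ((hvert hδ hδ1).const_smul Complex.I)
  have h0 := tendsto_nhds_unique hlim (tendsto_const_nhds.congr fun T => (hrect T).symm)
  rw [sub_zero, zero_add, ← smul_sub, smul_eq_zero, sub_eq_zero] at h0
  simpa using h0.resolve_left Complex.I_ne_zero

lemma integral_saddleIntegrand_scale {δ : ℝ} (hδ : 0 < δ) :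
    ∫ y : ℝ, saddleIntegrand (δ ^ 2)⁻¹ (δ + y * Complex.I) =
      ((δ ^ 5)⁻¹ : ℝ) * ∫ t : ℝ, scaledIntegrand δ t := by
  have h := Measure.integral_comp_mul_left
    (fun y : ℝ => saddleIntegrand (δ ^ 2)⁻¹ (δ + y * Complex.I)) δ
  have hδ' : (δ : ℂ) ≠ 0 := by exact_mod_cast hδ.ne'
  have hscale (t : ℝ) : saddleIntegrand (δ ^ 2)⁻¹ (δ + (δ * t : ℝ) * Complex.I) =
      ((δ ^ 6)⁻¹ : ℝ) * scaledIntegrand δ t := by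
    rw [saddleIntegrand, scaledIntegrand]
    have e1 : (δ + (δ * t : ℝ) * Complex.I : ℂ) = δ * (1 + t * Complex.I) := by push_cast; ring
    rw [e1]
    generalize (1 + t * Complex.I : ℂ) = z
    have e2 : (((δ ^ 2)⁻¹ : ℝ) : ℂ) * ((δ * z) ^ 2 - (δ * z) ^ 3 / 3) = z ^ 2 - δ * z ^ 3 / 3 := by
      push_cast; field_simp
    rw [e2, mul_pow]
    push_cast
    rw [mul_assoc, ← div_div, div_right_comm, div_eq_inv_mul]
  simp_rw [hscale] at h
  rw [integral_const_mul, abs_of_pos (inv_pos.2 hδ), Complex.real_smul] at h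
  generalize (∫ y : ℝ, saddleIntegrand (δ ^ 2)⁻¹ (δ + y * Complex.I)) = A at h ⊢
  have hA : A = δ * (((δ⁻¹ : ℝ) : ℂ) * A) := by
    push_cast
    field_simp
  rw [hA, ← h]
  push_cast
  field_simp

lemma one_le_norm_one_add_mul_I (t : ℝ) : 1 ≤ ‖(1 + t * Complex.I : ℂ)‖ :=
  le_trans (by simp) (Complex.re_le_norm _)

lemma one_le_norm_two_sub {δ : ℝ} (hδ : δ ≤ 1) (t : ℝ) :
    1 ≤ ‖(2 - δ * (1 + t * Complex.I) : ℂ)‖ :=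
  le_trans (by simp; linarith) (Complex.re_le_norm _)

lemma norm_exp_scaled_le {δ : ℝ} (hδ0 : 0 ≤ δ) (hδ : δ ≤ 1 / 2) (t : ℝ) :
    ‖Complex.exp ((1 + t * Complex.I) ^ 2 - δ * (1 + t * Complex.I) ^ 3 / 3)‖ ≤
      Real.exp 1 * Real.exp (-(1 / 2) * t ^ 2) := by
  rw [Complex.norm_exp, ← Real.exp_add, Real.exp_le_exp]
  have : ((1 + t * Complex.I : ℂ) ^ 2 - δ * (1 + t * Complex.I) ^ 3 / 3).re =
      1 - t ^ 2 - δ / 3 + δ * t ^ 2 := by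
    rw [show (1 + t * Complex.I : ℂ) ^ 2 - δ * (1 + t * Complex.I) ^ 3 / 3 =
      (1 - t ^ 2 - δ / 3 + δ * t ^ 2 : ℝ) + (2 * t - δ * t + δ * t ^ 3 / 3 : ℝ) * Complex.I by
        push_cast
        linear_combination (t ^ 2 - δ * t ^ 2 - δ * t ^ 3 * Complex.I / 3 : ℂ) * Complex.I_sq]
    simp [-Complex.ofReal_add, -Complex.ofReal_sub, -Complex.ofReal_mul, -Complex.ofReal_div]
  rw [this]
  nlinarith [mul_nonneg (sub_nonneg.2 hδ) (sq_nonneg t)]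

lemma norm_scaledIntegrand_le {δ : ℝ} (hδ0 : 0 ≤ δ) (hδ : δ ≤ 1 / 2) (t : ℝ) :
    ‖scaledIntegrand δ t‖ ≤ Real.exp 1 * Real.exp (-(1 / 2) * t ^ 2) := by
  rw [scaledIntegrand, norm_div, norm_mul, norm_pow, norm_pow]
  refine (div_le_self (norm_nonneg _) ?_).trans (norm_exp_scaled_le hδ0 hδ t)
  exact one_le_mul_of_one_le_of_one_le (one_le_pow₀ (one_le_norm_one_add_mul_I t))
    (one_le_pow₀ (one_le_norm_two_sub (by linarith) t))

lemma one_add_mul_I_ne_zero (t : ℝ) : (1 + t * Complex.I : ℂ) ≠ 0 :=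
  norm_pos_iff.1 (one_pos.trans_le (one_le_norm_one_add_mul_I t))

lemma two_sub_ne_zero {δ : ℝ} (hδ : δ ≤ 1) (t : ℝ) : (2 - δ * (1 + t * Complex.I) : ℂ) ≠ 0 :=
  norm_pos_iff.1 (one_pos.trans_le (one_le_norm_two_sub hδ t))

lemma scaledIntegrand_integrable {δ : ℝ} (hδ0 : 0 ≤ δ) (hδ : δ ≤ 1 / 2) :
    Integrable (scaledIntegrand δ) := by
  refine ((integrable_exp_neg_mul_sq (b := 1 / 2) (by norm_num)).const_mul (Real.exp 1)).mono' ?_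
    (Filter.Eventually.of_forall fun t => norm_scaledIntegrand_le hδ0 hδ t)
  refine Continuous.aestronglyMeasurable ?_
  unfold scaledIntegrand
  refine Continuous.div (by fun_prop) (by fun_prop) fun t => ?_
  exact mul_ne_zero (pow_ne_zero _ (one_add_mul_I_ne_zero t))
    (pow_ne_zero _ (two_sub_ne_zero (by linarith) t))

lemma hasDerivAt_scaledIntegrand {δ : ℝ} (hδ : δ ≤ 1) (t : ℝ) :
    HasDerivAt (fun d => scaledIntegrand d t)
      (Complex.exp ((1 + t * Complex.I) ^ 2 - δ * (1 + t * Complex.I) ^ 3 / 3) *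
        (-(1 / 3) / ((1 + t * Complex.I) ^ 3 * (2 - δ * (1 + t * Complex.I)) ^ 4) +
          4 / ((1 + t * Complex.I) ^ 5 * (2 - δ * (1 + t * Complex.I)) ^ 5))) δ := by
  unfold scaledIntegrand
  have hz := one_add_mul_I_ne_zero t
  have hw := two_sub_ne_zero hδ t
  generalize (1 + t * Complex.I : ℂ) = z at *
  have hid : HasDerivAt (fun d : ℝ => (d : ℂ)) 1 δ := Complex.ofRealCLM.hasDerivAt
  have h1 : HasDerivAt (fun d : ℝ => z ^ 2 - d * z ^ 3 / 3) (-(1 * z ^ 3 / 3)) δ :=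
    ((hid.mul_const (z ^ 3)).div_const 3).const_sub (z ^ 2)
  have h2 : HasDerivAt (fun d : ℝ => (2 - d * z) ^ 4) _ δ := ((hid.mul_const z).const_sub 2).pow 4
  have h3 := h1.cexp.div (h2.const_mul (z ^ 6)) (mul_ne_zero (pow_ne_zero _ hz) (pow_ne_zero _ hw))
  refine h3.congr_deriv ?_
  push_cast
  field_simp
  ring

lemma norm_scaledIntegrand_sub_le {δ : ℝ} (hδ0 : 0 ≤ δ) (hδ : δ ≤ 1 / 2) (t : ℝ) :
    ‖scaledIntegrand δ t - scaledIntegrand 0 t‖ ≤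
      δ * (5 * Real.exp 1 * Real.exp (-(1 / 2) * t ^ 2)) := by
  have h := Convex.norm_image_sub_le_of_norm_hasDerivWithin_le
    (f := fun d => scaledIntegrand d t) (s := Set.Icc 0 δ) (x := 0) (y := δ)
    (C := 5 * Real.exp 1 * Real.exp (-(1 / 2) * t ^ 2))
    (fun d hd => (hasDerivAt_scaledIntegrand (by linarith [hd.2]) t).hasDerivWithinAt)
    (fun d hd => ?_) (convex_Icc 0 δ) ⟨le_rfl, hδ0⟩ ⟨hδ0, le_rfl⟩
  · rwa [sub_zero, Real.norm_of_nonneg hδ0, mul_comm] at h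
  · have hz := one_le_norm_one_add_mul_I t
    have hw := one_le_norm_two_sub (δ := d) (by linarith [hd.2]) t
    rw [norm_mul]
    calc _ ≤ (Real.exp 1 * Real.exp (-(1 / 2) * t ^ 2)) * (1 / 3 + 4) := by
          refine mul_le_mul (norm_exp_scaled_le hd.1 (hd.2.trans hδ) t) ?_ (norm_nonneg _)
            (by positivity)
          refine (norm_add_le _ _).trans (add_le_add ?_ ?_)
          · rw [norm_div, norm_mul, norm_pow, norm_pow]
            refine (div_le_self (norm_nonneg _) ?_).trans (by norm_num)
            exact one_le_mul_of_one_le_of_one_le (one_le_pow₀ hz) (one_le_pow₀ hw)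
          · rw [norm_div, norm_mul, norm_pow, norm_pow]
            refine (div_le_self (norm_nonneg _) ?_).trans (by norm_num)
            exact one_le_mul_of_one_le_of_one_le (one_le_pow₀ hz) (one_le_pow₀ hw)
      _ ≤ _ := by nlinarith [mul_pos (Real.exp_pos 1) (Real.exp_pos (-(1 / 2) * t ^ 2))]

lemma norm_integral_scaledIntegrand_sub_le {δ : ℝ} (hδ0 : 0 ≤ δ) (hδ : δ ≤ 1 / 2) :
    ‖(∫ t, scaledIntegrand δ t) - ∫ t, scaledIntegrand 0 t‖ ≤
      δ * ∫ t : ℝ, 5 * Real.exp 1 * Real.exp (-(1 / 2) * t ^ 2) := by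
  rw [← integral_sub (scaledIntegrand_integrable hδ0 hδ)
    (scaledIntegrand_integrable le_rfl (by norm_num)), ← integral_const_mul]
  refine norm_integral_le_of_norm_le ?_
    (Filter.Eventually.of_forall fun t => norm_scaledIntegrand_sub_le hδ0 hδ t)
  exact ((integrable_exp_neg_mul_sq (by norm_num)).const_mul _).const_mul _

lemma integral_cexp_one_add_mul_I_sq :
    ∫ t : ℝ, Complex.exp ((1 + t * Complex.I) ^ 2) = (√Real.pi : ℝ) := by
  have h := integral_cexp_quadratic (b := -1) (by simp) (2 * Complex.I) 1
  have e (t : ℝ) : (1 + t * Complex.I : ℂ) ^ 2 = -1 * t ^ 2 + 2 * Complex.I * t + 1 := by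
    linear_combination (t ^ 2 : ℂ) * Complex.I_sq
  simp_rw [e]
  rw [h, mul_pow, Complex.I_sq, Real.sqrt_eq_rpow, Complex.ofReal_cpow Real.pi_nonneg]
  norm_num

lemma tendsto_primitive {l : Filter ℝ} (hl : Filter.Tendsto (fun t : ℝ => t ^ 2) l Filter.atTop) :
    Filter.Tendsto (fun t : ℝ => Complex.exp ((1 + t * Complex.I) ^ 2) *
      (-(1 / 5) / (1 + t * Complex.I) ^ 5 - 2 / 15 / (1 + t * Complex.I) ^ 3 -
        4 / 15 / (1 + t * Complex.I))) l (nhds 0) := by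
  have hlim : Filter.Tendsto (fun t : ℝ => Real.exp 1 * Real.exp (-((1 / 2) * t ^ 2))) l
      (nhds (Real.exp 1 * 0)) :=
    (Real.tendsto_exp_neg_atTop_nhds_zero.comp
      (hl.const_mul_atTop (show (0 : ℝ) < 1 / 2 by norm_num))).const_mul _
  rw [mul_zero] at hlim
  refine squeeze_zero_norm (fun t => ?_) hlim
  have hz := one_le_norm_one_add_mul_I t
  have hexp := norm_exp_scaled_le le_rfl (by norm_num) t
  rw [Complex.ofReal_zero, zero_mul, zero_div, sub_zero, neg_mul] at hexp
  rw [norm_mul]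
  refine (mul_le_of_le_one_right (norm_nonneg _) ?_).trans hexp
  refine ((norm_sub_le _ _).trans (add_le_add (norm_sub_le _ _) le_rfl)).trans ?_
  simp only [norm_div, norm_pow]
  have h5 := div_le_self (norm_nonneg (-(1 / 5) : ℂ)) (one_le_pow₀ hz (n := 5))
  have h3 := div_le_self (div_nonneg (norm_nonneg (2 : ℂ)) (norm_nonneg (15 : ℂ)))
    (one_le_pow₀ hz (n := 3))
  have h1 := div_le_self (div_nonneg (norm_nonneg (4 : ℂ)) (norm_nonneg (15 : ℂ))) hz
  norm_num at h5 h3 h1 ⊢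
  linarith

lemma integral_scaledIntegrand_zero : ∫ t, scaledIntegrand 0 t = (√Real.pi / 30 : ℝ) := by
  have hE : Integrable fun t : ℝ => Complex.exp ((1 + t * Complex.I) ^ 2) := by
    have h := integrable_cexp_quadratic (b := 1) (by simp) (2 * Complex.I) 1
    refine h.congr (Filter.Eventually.of_forall fun t => ?_)
    simp only
    congr 1
    linear_combination (-t ^ 2 : ℂ) * Complex.I_sq
  have hS := scaledIntegrand_integrable le_rfl (show (0 : ℝ) ≤ 1 / 2 by norm_num)
  have hint := (hS.const_mul 16).sub (hE.const_mul (8 / 15))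
  have hderiv (t : ℝ) : HasDerivAt (fun t : ℝ => -Complex.I * (Complex.exp ((1 + t * Complex.I) ^ 2) *
      (-(1 / 5) / (1 + t * Complex.I) ^ 5 - 2 / 15 / (1 + t * Complex.I) ^ 3 -
        4 / 15 / (1 + t * Complex.I))))
      (16 * scaledIntegrand 0 t - 8 / 15 * Complex.exp ((1 + t * Complex.I) ^ 2)) t := by
    have hz := one_add_mul_I_ne_zero t
    have hd : HasDerivAt (fun t : ℝ => (1 + t * Complex.I : ℂ)) Complex.I t := by
      simpa using ((Complex.ofRealCLM.hasDerivAt (x := t)).mul_const Complex.I).const_add 1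
    have h := ((hd.pow 2).cexp.mul ((((hasDerivAt_const t (-(1 / 5) : ℂ)).div (hd.pow 5)
      (pow_ne_zero _ hz)).sub ((hasDerivAt_const t (2 / 15 : ℂ)).div (hd.pow 3)
      (pow_ne_zero _ hz))).sub ((hasDerivAt_const t (4 / 15 : ℂ)).div hd hz))).const_mul
      (-Complex.I)
    refine h.congr_deriv ?_
    simp only [scaledIntegrand, Complex.ofReal_zero, zero_mul, zero_div, sub_zero, Pi.pow_apply,
      Pi.sub_apply, Pi.div_apply]
    generalize (1 + t * Complex.I : ℂ) = z at *
    field_simp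
    ring_nf
    simp only [Complex.I_sq]
    ring
  have h := integral_of_hasDerivAt_of_tendsto hderiv hint
    ((tendsto_primitive ((Filter.tendsto_pow_atTop two_ne_zero).comp
      Filter.tendsto_abs_atBot_atTop |>.congr fun t => sq_abs t)).const_mul _)
    ((tendsto_primitive (Filter.tendsto_pow_atTop two_ne_zero)).const_mul _)
  rw [integral_sub (hS.const_mul 16) (hE.const_mul (8 / 15)), integral_const_mul,
    integral_const_mul, integral_cexp_one_add_mul_I_sq] at h
  push_cast at h ⊢
  linear_combination h / 16

lemma psi_eq (ε τ : ℝ) : psi ε τ = 2 * Real.arctan (Real.sinh τ) -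
    (2 * ε ^ 3)⁻¹ * (Real.sinh τ + Real.sinh τ ^ 3 / 3) := by
  have h3 : Real.exp (3 * τ) - Real.exp (-(3 * τ)) = 2 * Real.sinh (3 * τ) := by
    rw [Real.sinh_eq]; ring
  have h1 : Real.exp τ - Real.exp (-τ) = 2 * Real.sinh τ := by rw [Real.sinh_eq]; ring
  rw [psi, h3, h1, Real.sinh_three_mul, mul_div_cancel_left₀ _ two_ne_zero]
  by_cases hε : ε = 0
  · simp [hε]
  · field_simp
    ring

lemma aa_pow_nine (τ : ℝ) : aa τ ^ 9 = 16 * √2 * (Real.cosh τ ^ 9)⁻¹ := by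
  have h : aa τ = √2 / Real.cosh τ := by
    rw [aa, Real.cosh_eq]
    field_simp
  have h2 : √2 ^ 9 = 16 * √2 := by
    rw [show √2 ^ 9 = (√2 ^ 2) ^ 4 * √2 by ring, Real.sq_sqrt zero_le_two]
    norm_num
  rw [h, div_pow, h2, div_eq_mul_inv]

lemma exp_neg_two_arctan_mul_I (s : ℝ) :
    Complex.exp (-((2 * Real.arctan s : ℝ) * Complex.I)) * (1 + s * Complex.I) =
      1 - s * Complex.I := by
  have hc : (Real.cos (Real.arctan s) : ℂ) ≠ 0 := by
    exact_mod_cast (Real.cos_arctan_pos s).ne'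
  have hs : (s : ℂ) = Real.sin (Real.arctan s) / Real.cos (Real.arctan s) := by
    rw [← Complex.ofReal_div, ← Real.tan_eq_sin_div_cos, Real.tan_arctan]
  generalize Real.arctan s = θ at hc hs
  have h1 : (1 + s * Complex.I : ℂ) = Complex.exp (θ * Complex.I) / Real.cos θ := by
    rw [Complex.exp_mul_I, hs, Complex.ofReal_cos, Complex.ofReal_sin] at *
    field_simp
  have h2 : (1 - s * Complex.I : ℂ) = Complex.exp (-(θ * Complex.I)) / Real.cos θ := by
    rw [← neg_mul, Complex.exp_mul_I, hs, Complex.cos_neg, Complex.sin_neg, Complex.ofReal_cos,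
      Complex.ofReal_sin] at *
    field_simp
    ring
  rw [h1, h2, ← mul_div_assoc, ← Complex.exp_add]
  congr 2
  push_cast
  ring

lemma re_saddleIntegrand_eq (lam s : ℝ) :
    Real.exp (-(2 * lam / 3)) * (saddleIntegrand lam (1 + s * Complex.I)).re =
      ((1 + s ^ 2) ^ 5)⁻¹ * Real.cos (2 * Real.arctan s - lam * (s + s ^ 3 / 3)) := by
  have hz : (1 + s * Complex.I : ℂ) ≠ 0 := fun h => by simpa using congrArg Complex.re h
  have hz' : (1 - s * Complex.I : ℂ) ≠ 0 := fun h => by simpa using congrArg Complex.re h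
  have hprod : ((1 + s ^ 2 : ℝ) : ℂ) = (1 + s * Complex.I) * (1 - s * Complex.I) := by
    push_cast
    linear_combination (s ^ 2 : ℂ) * Complex.I_sq
  have key : (Real.exp (-(2 * lam / 3)) : ℂ) * saddleIntegrand lam (1 + s * Complex.I) =
      (((1 + s ^ 2) ^ 5)⁻¹ : ℝ) *
        Complex.exp ((-(2 * Real.arctan s - lam * (s + s ^ 3 / 3)) : ℝ) * Complex.I) := by
    have e1 : Complex.exp ((-(2 * Real.arctan s - lam * (s + s ^ 3 / 3)) : ℝ) * Complex.I) =
        (1 - s * Complex.I) / (1 + s * Complex.I) *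
          Complex.exp (lam * (s + s ^ 3 / 3) * Complex.I) := by
      rw [← exp_neg_two_arctan_mul_I, mul_div_cancel_right₀ _ hz, ← Complex.exp_add]
      congr 1
      push_cast
      ring
    have e2 : (Real.exp (-(2 * lam / 3)) : ℂ) *
        Complex.exp (lam * ((1 + s * Complex.I) ^ 2 - (1 + s * Complex.I) ^ 3 / 3)) =
          Complex.exp (lam * (s + s ^ 3 / 3) * Complex.I) := by
      rw [Complex.ofReal_exp, ← Complex.exp_add]
      congr 1
      push_cast
      linear_combination (-(lam * s ^ 3 * Complex.I / 3) : ℂ) * Complex.I_sq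
    rw [saddleIntegrand, ← mul_div_assoc, e2, e1, Complex.ofReal_inv, Complex.ofReal_pow, hprod,
      show (2 - (1 + s * Complex.I) : ℂ) = 1 - s * Complex.I by ring]
    field_simp
  have := congrArg Complex.re key
  rw [Complex.re_ofReal_mul, Complex.re_ofReal_mul, Complex.exp_ofReal_mul_I_re, Real.cos_neg] at this
  exact this

lemma integral_eq_re_integral_saddleIntegrand {ε : ℝ} (hε : 0 < ε) :
    ∫ τ : ℝ, (aa τ) ^ 9 * Real.cos (psi ε τ) =
      16 * √2 * Real.exp (-1 / (3 * ε ^ 3)) *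
        (∫ y : ℝ, saddleIntegrand (2 * ε ^ 3)⁻¹ (1 + y * Complex.I)).re := by
  have hint := saddleIntegrand_integrable (lam := (2 * ε ^ 3)⁻¹) (by positivity) one_pos le_rfl
  rw [Complex.ofReal_one] at hint
  have hre := integral_re hint
  simp only [RCLike.re_eq_complex_re] at hre
  rw [← hre, ← integral_const_mul,
    integral_sinh_substitution fun s => 16 * √2 * Real.exp (-1 / (3 * ε ^ 3)) *
      (saddleIntegrand (2 * ε ^ 3)⁻¹ (1 + s * Complex.I)).re]
  refine integral_congr_ae (Filter.Eventually.of_forall fun τ => ?_)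
  have h := re_saddleIntegrand_eq (2 * ε ^ 3)⁻¹ (Real.sinh τ)
  rw [show -(2 * (2 * ε ^ 3)⁻¹ / 3) = -1 / (3 * ε ^ 3) by field_simp, ← psi_eq,
    add_comm 1 (Real.sinh τ ^ 2),
    ← Real.cosh_sq] at h
  have hc := (Real.cosh_pos τ).ne'
  simp only [aa_pow_nine]
  rw [mul_assoc (16 * √2) (Real.exp _), h]
  field_simp

/-- `ε⁴ ∫ a⁹ cos ψ_ε dτ = (2√2/15) √(π/2) ε^{−7/2} e^{−1/(3ε³)} + O(ε^{−2} e^{−1/(3ε³)})`. -/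
theorem I_odd_dominant_asymptotics :
    ∃ C > (0 : ℝ), ∃ ε₁ > (0 : ℝ), ∀ ε : ℝ, 0 < ε → ε < ε₁ →
      |ε ^ 4 * (∫ τ : ℝ, (aa τ) ^ 9 * Real.cos (psi ε τ))
          - (2 * Real.sqrt 2 / 15) * Real.sqrt (Real.pi / 2) * ε ^ (-(7 : ℝ) / 2) *
            Real.exp (-1 / (3 * ε ^ 3))|
        ≤ C * ε ^ (-(2 : ℝ)) * Real.exp (-1 / (3 * ε ^ 3)) := by
  set M : ℝ := ∫ t : ℝ, 5 * Real.exp 1 * Real.exp (-(1 / 2) * t ^ 2) with hM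
  have hM0 : 0 ≤ M := integral_nonneg fun t => by positivity
  refine ⟨4 * √2 * M + 1, by positivity, 1 / 2, by norm_num, fun ε hε hε1 => ?_⟩
  obtain ⟨q, hq, rfl⟩ : ∃ q : ℝ, 0 < q ∧ q ^ 2 = ε := ⟨√ε, Real.sqrt_pos.2 hε, Real.sq_sqrt hε.le⟩
  have h2 : √2 ^ 2 = 2 := Real.sq_sqrt zero_le_two
  have hδ : 0 < √2 * q ^ 3 := by positivity
  have hδ2 : (√2 * q ^ 3) ^ 2 = 2 * (q ^ 2) ^ 3 := by rw [mul_pow, h2]; ring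
  have hδ1 : √2 * q ^ 3 ≤ 1 / 2 := by
    refine abs_le_of_sq_le_sq' ?_ (by norm_num) |>.2
    rw [hδ2]
    have := pow_le_pow_left₀ hε.le hε1.le 3
    linarith
  have hp7 : (q ^ 2) ^ (-(7 : ℝ) / 2) = (q ^ 7)⁻¹ := by
    rw [← Real.rpow_natCast, ← Real.rpow_mul hq.le, ← Real.rpow_natCast, ← Real.rpow_neg hq.le]
    norm_num
  have hp2 : (q ^ 2) ^ (-(2 : ℝ)) = (q ^ 4)⁻¹ := by
    rw [← Real.rpow_natCast, ← Real.rpow_mul hq.le, ← Real.rpow_natCast, ← Real.rpow_neg hq.le]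
    norm_num
  have hmain : √2 * √(Real.pi / 2) = √Real.pi := by
    rw [← Real.sqrt_mul zero_le_two, mul_div_cancel₀ _ two_ne_zero]
  have hdiff := norm_integral_scaledIntegrand_sub_le hδ.le hδ1
  rw [integral_scaledIntegrand_zero, ← hM] at hdiff
  have hre := (Complex.abs_re_le_norm _).trans hdiff
  rw [Complex.sub_re, Complex.ofReal_re] at hre
  rw [integral_eq_re_integral_saddleIntegrand hε,
    integral_saddleIntegrand_shift (by positivity) hδ (by linarith), ← hδ2,
    integral_saddleIntegrand_scale hδ, Complex.re_ofReal_mul, hp7, hp2]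
  set J := (∫ t : ℝ, scaledIntegrand (√2 * q ^ 3) t).re
  set E := Real.exp (-1 / (3 * (q ^ 2) ^ 3))
  have hE : 0 < E := Real.exp_pos _
  have h5 : (√2 * q ^ 3) ^ 5 = 4 * √2 * q ^ 15 := by
    rw [mul_pow, show √2 ^ 5 = (√2 ^ 2) ^ 2 * √2 by ring, h2]; ring
  have heq : (q ^ 2) ^ 4 * (16 * √2 * E * (((√2 * q ^ 3) ^ 5)⁻¹ * J)) -
      2 * √2 / 15 * √(Real.pi / 2) * (q ^ 7)⁻¹ * E =
      4 * (q ^ 7)⁻¹ * E * (J - √Real.pi / 30) := by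
    rw [h5, ← hmain]
    field_simp
    ring
  rw [heq, abs_mul, abs_of_pos (by positivity)]
  calc 4 * (q ^ 7)⁻¹ * E * |J - √Real.pi / 30|
      ≤ 4 * (q ^ 7)⁻¹ * E * (√2 * q ^ 3 * M) := by gcongr
    _ = 4 * √2 * M * (q ^ 4)⁻¹ * E := by field_simp
    _ ≤ (4 * √2 * M + 1) * (q ^ 4)⁻¹ * E := by gcongr; linarith
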